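/- arXiv:2003.09138 — 2 statements merged into one kernel-verified Lean document; each statement's English description precedes it below -/
import Mathlib

section
/- Let 1 → A →α B →β C → 1 be a short exact sequence of abelian Γ-groups (α, β are Γ-equivariant group homomorphisms, α injective, β surjective, ker β = α(A)), and let U be a cover of a left Γ-set X. Let φ ∈ K^p_Γ(U,X,C) be a p-cocycle (∂φ = 0) and suppose ψ ∈ K^p_Γ(U,X,B) satisfies β ∘ ψ = φ componentwise. Then: (i) ∂ψ takes values in α(A); (ii) the unique ν ∈ K^{p+1}_Γ(U,X,A) with α ∘ ν = ∂ψ satisfies ∂ν = 0; (iii) the cohomology class [ν] ∈ H^{p+1}_Γ(U,X,A) does not depend on the choice of the lift ψ: for any other ψ′ ∈ K^p_Γ(U,X,B) with β ∘ ψ′ = φ, the corresponding ν′ differs from ν by a coboundary. -/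
namespace SemiDD

/-- Extend a finite tuple by `1` outside its range. -/
def ext {G : Type*} [One G] {n : ℕ} (f : Fin n → G) (m : ℕ) : G :=
  if h : m < n then f ⟨m, h⟩ else 1

/-- The face maps `d_i : X^{p+1} → X^p` of the simplicial space `X^• = {Γ^p × X}`. -/
def face {Γ X : Type*} [Group Γ] [MulAction Γ X] {p : ℕ} (i : ℕ)
    (z : (Fin (p + 1) → Γ) × X) : (Fin p → Γ) × X :=
  (fun k => if (k : ℕ) + 1 < i then ext z.1 (k : ℕ)
    else if (k : ℕ) + 1 = i then ext z.1 (k : ℕ) * ext z.1 ((k : ℕ) + 1)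
    else ext z.1 ((k : ℕ) + 1),
   if i = p + 1 then ext z.1 p • z.2 else z.2)

/-- The degeneracy maps `e_i : X^p → X^{p+1}` of the simplicial space. -/
def degen {Γ X : Type*} [One Γ] {p : ℕ} (i : ℕ)
    (z : (Fin p → Γ) × X) : (Fin (p + 1) → Γ) × X :=
  (fun k => if (k : ℕ) < i then ext z.1 (k : ℕ)
    else if (k : ℕ) = i then 1
    else ext z.1 ((k : ℕ) - 1), z.2)

/-- The simplicial twisting maps `θ_i^{x^p} : G → G`: `θ_0^{(γ_1,…,γ_p,x)} = θ_{γ_1}`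
and `θ_i = id` for `i ≥ 1`. -/
def twist {Γ G : Type*} [Group Γ] [Group G] [MulDistribMulAction Γ G]
    {X : Type*} {p : ℕ} (i : ℕ) (z : (Fin p → Γ) × X) (g : G) : G :=
  if i = 0 then ext z.1 0 • g else g

/-- The point `x^p_i = γ_{i+1}⋯γ_p • x` associated to `x^p = (γ_1,…,γ_p,x) ∈ X^p`. -/
def pt {Γ X : Type*} [Group Γ] [MulAction Γ X] {p : ℕ}
    (z : (Fin p → Γ) × X) (i : ℕ) : X :=
  (((List.range p).drop i).map (ext z.1)).prod • z.2

/-- The subset `U_{(a_0,…,a_p)} ⊆ X^p` of the simplicial cover. -/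
def tupSet {Γ X ι : Type*} [Group Γ] [MulAction Γ X] (U : ι → Set X)
    {p : ℕ} (a : Fin (p + 1) → ι) : Set ((Fin p → Γ) × X) :=
  {z | ∀ i : Fin (p + 1), pt z (i : ℕ) ∈ U (a i)}

/-- The face map on index tuples: delete the `i`-th entry. -/
def faceIdx {ι : Type*} {n : ℕ} (i : ℕ) (a : Fin (n + 1) → ι) : Fin n → ι :=
  fun k => if (k : ℕ) < i then a k.castSucc else a k.succ

/-- The group `K^p_Γ(U,X,(G,θ))` of `p`-cochains. -/
abbrev K (Γ : Type*) {X ι : Type*} [Group Γ] [MulAction Γ X]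
    (U : ι → Set X) (G : Type*) [Group G] (p : ℕ) :=
  ∀ a : Fin (p + 1) → ι, tupSet (Γ := Γ) U a → G

open Classical in
/-- The twisted pullback maps `δ_i : K^p → K^{p+1}`. -/
noncomputable def tpb {Γ X ι G : Type*} [Group Γ] [MulAction Γ X] [Group G]
    [MulDistribMulAction Γ G] {U : ι → Set X} {p : ℕ} (i : ℕ)
    (φ : K Γ U G p) : K Γ U G (p + 1) :=
  fun a z =>
    twist i z.1
      (if h : face i z.1 ∈ tupSet (Γ := Γ) U (faceIdx i a) then
        φ (faceIdx i a) ⟨face i z.1, h⟩ else 1)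

/-- The coboundary `∂ = Σ_{i=0}^{p+1} (−1)^i δ_i : K^p → K^{p+1}` (written
multiplicatively, as an ordered product; for abelian coefficients this is the
alternating sum of the twisted pullbacks). -/
noncomputable def cob {Γ X ι G : Type*} [Group Γ] [MulAction Γ X] [Group G]
    [MulDistribMulAction Γ G] {U : ι → Set X} {p : ℕ}
    (φ : K Γ U G p) : K Γ U G (p + 1) :=
  ((List.range (p + 2)).map (fun i => tpb i φ ^ ((-1 : ℤ) ^ i))).prod

/-- The map on cochains induced by a map of coefficient groups. -/
def mapK {Γ X ι : Type*} [Group Γ] [MulAction Γ X] {U : ι → Set X}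
    {A B : Type*} [Group A] [Group B] (f : A → B) {p : ℕ}
    (φ : K Γ U A p) : K Γ U B p :=
  fun a z => f (φ a z)

/-- The restriction map on cochains induced by a refinement `r` of covers. -/
def res {Γ X ι κ G : Type*} [Group Γ] [MulAction Γ X] [Group G]
    {U : ι → Set X} {V : κ → Set X} (r : κ → ι)
    (hr : ∀ b, V b ⊆ U (r b)) {p : ℕ} (φ : K Γ U G p) : K Γ V G p :=
  fun b z => φ (fun i => r (b i)) ⟨z.1, fun i => hr (b i) (z.2 i)⟩

/-- A `Γ`-semi-equivariant (G,θ)-valued transition cocycle over the cover `U`. -/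
def IsCocycle {Γ X G ι : Type*} [Group Γ] [MulAction Γ X] [Group G]
    [MulDistribMulAction Γ G] (U : ι → Set X) (φ : ι → ι → Γ → X → G) : Prop :=
  (∀ (a : ι) (x : X), x ∈ U a → φ a a 1 x = 1) ∧
  (∀ (γ' γ : Γ) (a b c : ι) (x : X), x ∈ U a → γ • x ∈ U b →
    (γ' * γ) • x ∈ U c →
    φ c a (γ' * γ) x = φ c b γ' (γ • x) * γ' • φ b a γ x)

/-- Set-theoretic data of a `Γ`-semi-equivariant principal `(G,θ)`-bundle over
a left `Γ`-set `X`. -/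
structure SEBundle (Γ X G : Type*) [Group Γ] [MulAction Γ X] [Group G]
    [MulDistribMulAction Γ G] where
  P : Type*
  π : P → X
  surj : Function.Surjective π
  actG : P → G → P
  actG_one : ∀ p, actG p 1 = p
  actG_mul : ∀ p g g', actG (actG p g) g' = actG p (g * g')
  π_actG : ∀ p g, π (actG p g) = π p
  freeTrans : ∀ p q, π p = π q → ∃! g, actG p g = q
  actΓ : Γ → P → P
  actΓ_one : ∀ p, actΓ 1 p = p
  actΓ_mul : ∀ γ' γ p, actΓ γ' (actΓ γ p) = actΓ (γ' * γ) p
  π_actΓ : ∀ γ p, π (actΓ γ p) = γ • π p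
  semi : ∀ γ p g, actΓ γ (actG p g) = actG (actΓ γ p) (γ • g)

/-- The total space `⨆_{a} {a} × U_a × G` used in reconstructing a bundle
from a transition cocycle. -/
def Tot {X ι : Type*} (U : ι → Set X) (G : Type*) :=
  Σ a : ι, (U a) × G

/-- The gluing relation `(a,x,g) ~ (b,x,φ_{ba}(1,x)·g)`. -/
def rel {Γ X G ι : Type*} [One Γ] [Mul G] (U : ι → Set X)
    (φ : ι → ι → Γ → X → G) (z w : Tot U G) : Prop :=
  (z.2.1 : X) = (w.2.1 : X) ∧ w.2.2 = φ w.1 z.1 (1 : Γ) (z.2.1 : X) * z.2.2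

/-- The total space `P^φ` of the bundle reconstructed from a transition
cocycle `φ`. -/
def PB {Γ X G ι : Type*} [One Γ] [Mul G] (U : ι → Set X)
    (φ : ι → ι → Γ → X → G) :=
  Quot (rel U φ)

/-- The projection `π : P^φ → X`, `[a,x,g] ↦ x`. -/
def pbProj {Γ X G ι : Type*} [One Γ] [Mul G] {U : ι → Set X}
    {φ : ι → ι → Γ → X → G} : PB U φ → X :=
  Quot.lift (fun z => (z.2.1 : X)) (fun _ _ h => h.1)

/-- The right `G`-action on `P^φ`, `[a,x,g]·g' = [a,x,g·g']`. -/
def pbActG {Γ X G ι : Type*} [One Γ] [Group G] {U : ι → Set X}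
    {φ : ι → ι → Γ → X → G} (g' : G) : PB U φ → PB U φ :=
  Quot.lift (fun z => Quot.mk (rel U φ) ⟨z.1, ⟨z.2.1, z.2.2 * g'⟩⟩)
    (fun z w h => Quot.sound
      ⟨h.1, show w.2.2 * g' = φ w.1 z.1 (1 : Γ) (z.2.1 : X) * (z.2.2 * g') from
        by rw [h.2, mul_assoc]⟩)

/-- Specification of the left `Γ`-action `γ·[a,x,g] = [b, γ·x, φ_{ba}(γ,x)·(γ·g)]`
on `P^φ`. -/
def pbActSpec {Γ X G ι : Type*} [Group Γ] [MulAction Γ X] [Group G]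
    [MulDistribMulAction Γ G] (U : ι → Set X) (φ : ι → ι → Γ → X → G)
    (act : Γ → PB U φ → PB U φ) : Prop :=
  ∀ (γ : Γ) (a : ι) (x : X) (hx : x ∈ U a) (g : G) (b : ι) (hb : γ • x ∈ U b),
    act γ (Quot.mk (rel U φ) ⟨a, ⟨⟨x, hx⟩, g⟩⟩) =
      Quot.mk (rel U φ) ⟨b, ⟨⟨γ • x, hb⟩, φ b a γ x * γ • g⟩⟩

theorem ext_face {Γ X : Type*} [Group Γ] [MulAction Γ X] {p : ℕ} (i : ℕ)
    (z : (Fin (p + 1) → Γ) × X) {m : ℕ} (hm : m < p) :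
    ext (face i z).1 m = if m + 1 < i then ext z.1 m
      else if m + 1 = i then ext z.1 m * ext z.1 (m + 1) else ext z.1 (m + 1) := by
  rw [ext, dif_pos hm]
  rfl

theorem face_face {Γ X : Type*} [Group Γ] [MulAction Γ X] {p i j : ℕ} (hij : i ≤ j)
    (hj : j ≤ p + 1) (z : (Fin (p + 2) → Γ) × X) :
    face i (face (j + 1) z) = face j (face i z) := by
  refine Prod.ext (funext fun k => ?_) ?_
  · have hk := k.2
    simp only [face.eq_def (p := p)]
    rw [ext_face _ _ (by omega : (k : ℕ) < p + 1), ext_face _ _ (by omega : (k : ℕ) + 1 < p + 1),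
      ext_face _ _ (by omega : (k : ℕ) < p + 1), ext_face _ _ (by omega : (k : ℕ) + 1 < p + 1)]
    split_ifs <;> first | rfl | omega | exact (mul_assoc _ _ _).symm
  · simp only [face.eq_def (p := p)]
    rw [ext_face _ _ (by omega : p < p + 1), ext_face _ _ (by omega : p < p + 1)]
    simp only [face]
    split_ifs <;> first | rfl | omega | exact mul_smul _ _ _ | exact (mul_smul _ _ _).symm

theorem faceIdx_faceIdx {ι : Type*} {n i j : ℕ} (hij : i ≤ j) (a : Fin (n + 2) → ι) :
    faceIdx i (faceIdx (j + 1) a) = faceIdx j (faceIdx i a) := by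
  funext k
  simp only [faceIdx, Fin.val_castSucc, Fin.val_succ]
  split_ifs <;> first | rfl | omega

theorem pt_last {Γ X : Type*} [Group Γ] [MulAction Γ X] {p : ℕ} (z : (Fin p → Γ) × X) :
    pt z p = z.2 := by
  rw [pt, List.drop_eq_nil_of_le (by simp), List.map_nil, List.prod_nil, one_smul]

theorem pt_of_lt {Γ X : Type*} [Group Γ] [MulAction Γ X] {p : ℕ} (z : (Fin p → Γ) × X) {k : ℕ}
    (hk : k < p) : pt z k = ext z.1 k • pt z (k + 1) := by
  rw [pt, List.drop_eq_getElem_cons (by simpa using hk)]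
  simp [pt, mul_smul]

theorem pt_face {Γ X : Type*} [Group Γ] [MulAction Γ X] {p i : ℕ} (hi : i ≤ p + 1)
    (z : (Fin (p + 1) → Γ) × X) {k : ℕ} (hk : k ≤ p) :
    pt (face i z) k = pt z (if k < i then k else k + 1) := by
  induction hk using Nat.decreasingInduction with
  | self =>
    rw [pt_last]
    by_cases h : i = p + 1
    · rw [if_pos (by omega), pt_of_lt z (by omega), pt_last, face, if_pos h]
    · rw [if_neg (by omega), pt_last, face, if_neg h]
  | of_succ k hk ih =>
    rw [pt_of_lt _ hk, ih, ext_face _ _ hk]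
    rcases lt_trichotomy (k + 1) i with h | h | h
    · rw [if_pos h, if_pos h, if_pos (by omega), ← pt_of_lt z (by omega)]
    · rw [if_neg (by omega), if_pos h, if_neg (by omega), if_pos (by omega), mul_smul,
        ← pt_of_lt z (by omega), ← pt_of_lt z (by omega)]
    · rw [if_neg (by omega), if_neg (by omega), if_neg (by omega), if_neg (by omega),
        ← pt_of_lt z (by omega)]

theorem face_mem_tupSet {Γ X ι : Type*} [Group Γ] [MulAction Γ X] {U : ι → Set X} {p i : ℕ}
    (hi : i ≤ p + 1) {a : Fin (p + 2) → ι} {z : (Fin (p + 1) → Γ) × X}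
    (hz : z ∈ tupSet (Γ := Γ) U a) : face i z ∈ tupSet (Γ := Γ) U (faceIdx i a) := by
  intro k
  rw [pt_face hi z (by omega)]
  simp only [faceIdx]
  split_ifs
  · exact hz k.castSucc
  · exact hz k.succ

theorem twist_twist {Γ X G : Type*} [Group Γ] [MulAction Γ X] [Group G]
    [MulDistribMulAction Γ G] {p i j : ℕ} (hij : i ≤ j) (z : (Fin (p + 2) → Γ) × X) (g : G) :
    twist (j + 1) z (twist i (face (j + 1) z) g) = twist i z (twist j (face i z) g) := by
  rcases i with _ | i
  · rcases j with _ | j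
    · simp [twist, ext_face _ _ (Nat.succ_pos p), mul_smul]
    · simp [twist, ext_face _ _ (Nat.succ_pos p)]
  · obtain ⟨j, rfl⟩ : ∃ k, j = k + 1 := ⟨j - 1, by omega⟩
    simp [twist]

/-- The twisting maps as group homomorphisms. -/
def twistHom {Γ G X : Type*} [Group Γ] [Group G] [MulDistribMulAction Γ G] {p : ℕ} (i : ℕ)
    (z : (Fin p → Γ) × X) : G →* G where
  toFun := twist i z
  map_one' := by simp [twist]
  map_mul' g h := by simp only [twist]; split_ifs <;> simp

/-- The twisted pullbacks as group homomorphisms. -/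
noncomputable def tpbHom {Γ X ι G : Type*} [Group Γ] [MulAction Γ X] [Group G]
    [MulDistribMulAction Γ G] (U : ι → Set X) (p i : ℕ) : K Γ U G p →* K Γ U G (p + 1) where
  toFun := tpb i
  map_one' := by
    funext a z
    simp only [tpb, Pi.one_apply, dite_eq_ite, ite_self]
    exact map_one (twistHom i z.1)
  map_mul' φ ψ := by
    funext a z
    refine Eq.trans ?_ (map_mul (twistHom i z.1) _ _)
    refine congrArg (twist i z.1) ?_
    split_ifs <;> simp

theorem mapK_injective {Γ X ι A B : Type*} [Group Γ] [MulAction Γ X] [Group A] [Group B]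
    {U : ι → Set X} {f : A → B} (hf : Function.Injective f) {p : ℕ} :
    Function.Injective (mapK f : K Γ U A p → K Γ U B p) :=
  fun _ _ h => funext fun a => funext fun z => hf (congrFun (congrFun h a) z)

theorem mapK_mul {Γ X ι A B : Type*} [Group Γ] [MulAction Γ X] [Group A] [Group B]
    {U : ι → Set X} (f : A →* B) {p : ℕ} (φ ψ : K Γ U A p) :
    mapK f (φ * ψ) = mapK f φ * mapK f ψ :=
  funext fun _ => funext fun _ => map_mul f _ _

theorem mapK_one {Γ X ι A B : Type*} [Group Γ] [MulAction Γ X] [Group A] [Group B]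
    {U : ι → Set X} (f : A →* B) {p : ℕ} : mapK f (1 : K Γ U A p) = 1 :=
  funext fun _ => funext fun _ => map_one f

section CommGroup

variable {Γ X ι : Type*} [Group Γ] [MulAction Γ X] {U : ι → Set X}
  {A B : Type*} [CommGroup A] [MulDistribMulAction Γ A] [CommGroup B] [MulDistribMulAction Γ B]

theorem cob_eq_prod {p : ℕ} (φ : K Γ U A p) :
    cob φ = ∏ i ∈ Finset.range (p + 2), tpbHom U p i φ ^ ((-1 : ℤ) ^ i) :=
  rfl

theorem cob_mul {p : ℕ} (φ ψ : K Γ U A p) : cob (φ * ψ) = cob φ * cob ψ := by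
  simp only [cob_eq_prod, map_mul, mul_zpow, Finset.prod_mul_distrib]

theorem tpb_apply {p i : ℕ} (hi : i ≤ p + 1) (φ : K Γ U A p) (a : Fin (p + 2) → ι)
    (z : tupSet (Γ := Γ) U a) :
    tpb i φ a z = twist i z.1 (φ (faceIdx i a) ⟨face i z.1, face_mem_tupSet hi z.2⟩) := by
  rw [tpb, dif_pos (face_mem_tupSet hi z.2)]

theorem tpb_tpb {p i j : ℕ} (hij : i ≤ j) (hj : j ≤ p + 1) (φ : K Γ U A p) :
    tpb (j + 1) (tpb i φ) = tpb i (tpb j φ) := by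
  have key : ∀ (a a' : Fin (p + 1) → ι) (z z' : (Fin p → Γ) × X)
      (hz : z ∈ tupSet (Γ := Γ) U a) (hz' : z' ∈ tupSet (Γ := Γ) U a'), a = a' → z = z' →
      φ a ⟨z, hz⟩ = φ a' ⟨z', hz'⟩ := by
    rintro a _ z _ _ _ rfl rfl
    rfl
  funext a z
  rw [tpb_apply (by omega), tpb_apply (by omega), tpb_apply (by omega), tpb_apply hj,
    twist_twist hij]
  congr 2
  exact key _ _ _ _ _ _ (faceIdx_faceIdx hij a) (face_face hij hj z.1)

theorem prod_alternating_eq_one {M : Type*} [CommGroup M] (f : ℕ → ℕ → M) (n : ℕ)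
    (hf : ∀ i j, i ≤ j → j < n → f (j + 1) i = f i j) :
    ∏ j ∈ Finset.range (n + 1), ∏ i ∈ Finset.range n, f j i ^ ((-1 : ℤ) ^ (i + j)) = 1 := by
  induction n with
  | zero => simp
  | succ n ih =>
    rw [Finset.prod_range_succ]
    simp only [fun j => Finset.prod_range_succ (fun i => f j i ^ ((-1 : ℤ) ^ (i + j))) n]
    rw [Finset.prod_mul_distrib, ih fun i j hij hj => hf i j hij (by omega), one_mul,
      ← Finset.prod_range_succ (fun i => f (n + 1) i ^ ((-1 : ℤ) ^ (i + (n + 1)))) n,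
      ← Finset.prod_mul_distrib]
    refine Finset.prod_eq_one fun i hi => ?_
    rw [hf i n (Nat.lt_succ_iff.1 (Finset.mem_range.1 hi)) n.lt_succ_self, ← zpow_add,
      ← add_assoc, pow_succ, add_comm i n, mul_neg_one, add_neg_cancel, zpow_zero]

theorem cob_cob {p : ℕ} (φ : K Γ U A p) : cob (cob φ) = 1 := by
  rw [cob_eq_prod, cob_eq_prod]
  simp only [map_prod, map_zpow, ← Finset.prod_zpow, ← zpow_mul, ← pow_add]
  exact prod_alternating_eq_one (fun j i => tpbHom U (p + 1) j (tpbHom U p i φ)) (p + 2)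
    fun i j hij hj => tpb_tpb hij (by omega) φ

theorem mapK_tpb (f : A →* B) (hf : ∀ (γ : Γ) (g : A), f (γ • g) = γ • f g) {p : ℕ} (i : ℕ)
    (φ : K Γ U A p) : mapK f (tpb i φ) = tpb i (mapK f φ) := by
  funext a z
  simp only [mapK, tpb, twist]
  split_ifs <;> simp [hf]

theorem mapK_cob (f : A →* B) (hf : ∀ (γ : Γ) (g : A), f (γ • g) = γ • f g) {p : ℕ}
    (φ : K Γ U A p) : mapK f (cob φ) = cob (mapK f φ) := by
  funext a z
  simp only [cob_eq_prod, mapK, Finset.prod_apply, Pi.pow_apply, map_prod, map_zpow]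
  refine Finset.prod_congr rfl fun i _ => congrArg (· ^ ((-1 : ℤ) ^ i)) ?_
  exact congrFun (congrFun (mapK_tpb f hf i φ) a) z

end CommGroup

/-- the connecting map of a short exact sequence of abelian
Γ-groups: for a `p`-cocycle `φ` with values in `C` and a lift `ψ` along `β`,
`∂ψ` takes values in `α(A)`, the cochain `ν` with `α∘ν = ∂ψ` is a cocycle,
and its class is independent of the chosen lift. -/
theorem statement14 {Γ X ι A B C : Type*} [Group Γ] [MulAction Γ X]
    [CommGroup A] [CommGroup B] [CommGroup C] [MulDistribMulAction Γ A]
    [MulDistribMulAction Γ B] [MulDistribMulAction Γ C]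
    (U : ι → Set X) (α : A →* B) (β : B →* C)
    (hαΓ : ∀ (γ : Γ) (g : A), α (γ • g) = γ • α g)
    (hβΓ : ∀ (γ : Γ) (g : B), β (γ • g) = γ • β g)
    (hαinj : Function.Injective ⇑α) (hβsurj : Function.Surjective ⇑β)
    (hexact : ∀ b : B, β b = 1 ↔ b ∈ Set.range ⇑α)
    (p : ℕ) (φ : K Γ U C p) (hφ : cob φ = 1)
    (ψ : K Γ U B p) (hψ : mapK (⇑β) ψ = φ) :
    (∀ (a : Fin (p + 2) → ι) (z : tupSet (Γ := Γ) U a),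
      cob ψ a z ∈ Set.range ⇑α) ∧
    (∀ ν : K Γ U A (p + 1), mapK (⇑α) ν = cob ψ → cob ν = 1) ∧
    (∀ (ψ' : K Γ U B p) (ν ν' : K Γ U A (p + 1)),
      mapK (⇑β) ψ' = φ → mapK (⇑α) ν = cob ψ → mapK (⇑α) ν' = cob ψ' →
      ∃ η : K Γ U A p, ν' = ν * cob η) := by
  refine ⟨fun a z => ?_, fun ν hν => ?_, fun ψ' ν ν' hψ' hν hν' => ?_⟩
  · rw [← hexact]
    have h := mapK_cob β hβΓ ψ
    rw [hψ, hφ] at h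
    exact congrFun (congrFun h a) z
  · apply mapK_injective hαinj
    rw [mapK_cob α hαΓ, hν, cob_cob, mapK_one]
  · have h (a : Fin (p + 1) → ι) (z : tupSet (Γ := Γ) U a) :
        ∃ g : A, α g = (ψ a z)⁻¹ * ψ' a z := by
      have h₁ := congrFun (congrFun (hψ.trans hψ'.symm) a) z
      simp only [mapK] at h₁
      refine (hexact _).1 ?_
      rw [map_mul, map_inv, h₁, inv_mul_cancel]
    choose η hη using h
    have hη' : ψ * mapK α η = ψ' := by
      funext a z
      simp [mapK, hη]
    refine ⟨η, mapK_injective hαinj ?_⟩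
    rw [mapK_mul, mapK_cob α hαΓ, hν, hν', ← cob_mul, hη']

end SemiDD
end

section
/- Let 1 → A →α B →β C → 1 be a central extension of Γ-groups, U a cover of a left Γ-set X, and φ ∈ K^1_Γ(U,X,C) a 1-cocycle, i.e. (δ_1φ)^{−1}(δ_2φ)(δ_0φ) = 1. Suppose there exists ψ ∈ K^1_Γ(U,X,B) with β ∘ ψ = φ, and let ν̄ ∈ K^2_Γ(U,X,A) be the unique cochain with α ∘ ν̄ = (δ_1ψ)^{−1}(δ_2ψ)(δ_0ψ) (then ∂ν̄ = 0, and its class DD(φ) := [ν̄] ∈ H^2_Γ(U,X,A), the semi-equivariant Dixmier–Douady invariant, is independent of the choice of ψ). Then there exists a lifting of φ to a 1-cocycle with values in B — that is, ψ′ ∈ K^1_Γ(U,X,B) with β ∘ ψ′ = φ and (δ_1ψ′)^{−1}(δ_2ψ′)(δ_0ψ′) = 1 — if and only if DD(φ) = 0 in H^2_Γ(U,X,A). -/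
namespace SemiDD

theorem tpb_mul {Γ X ι G : Type*} [Group Γ] [MulAction Γ X] [Group G]
    [MulDistribMulAction Γ G] {U : ι → Set X} {p : ℕ} (i : ℕ) (φ ψ : K Γ U G p) :
    tpb i (φ * ψ) = tpb i φ * tpb i ψ := by
  funext a z
  simp only [tpb, twist, Pi.mul_apply]
  split_ifs <;> simp

theorem tpb_mapK {Γ X ι A B : Type*} [Group Γ] [MulAction Γ X] [Group A] [Group B]
    [MulDistribMulAction Γ A] [MulDistribMulAction Γ B] {U : ι → Set X} (f : A →* B)
    (hf : ∀ (γ : Γ) (g : A), f (γ • g) = γ • f g) {p : ℕ} (i : ℕ) (φ : K Γ U A p) :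
    tpb i (mapK (⇑f) φ) = mapK (⇑f) (tpb i φ) := by
  funext a z
  simp only [tpb, twist, mapK]
  split_ifs <;> simp [hf]

theorem cob_one {Γ X ι A : Type*} [Group Γ] [MulAction Γ X] [CommGroup A]
    [MulDistribMulAction Γ A] {U : ι → Set X} (η : K Γ U A 1) :
    cob η = tpb 0 η * (tpb 1 η)⁻¹ * tpb 2 η := by
  simp [cob, List.range_succ, mul_assoc]

/-- Twisting a `1`-cochain by a central cochain changes its failure to be a cocycle by the
coboundary of that cochain. -/
theorem cocycleDefect_mul_mapK {Γ X ι A B : Type*} [Group Γ] [MulAction Γ X]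
    [CommGroup A] [Group B] [MulDistribMulAction Γ A] [MulDistribMulAction Γ B]
    {U : ι → Set X} (α : A →* B) (hαΓ : ∀ (γ : Γ) (g : A), α (γ • g) = γ • α g)
    (hcentral : ∀ (x : A) (b : B), α x * b = b * α x) (ψ : K Γ U B 1) (η : K Γ U A 1) :
    (tpb 1 (ψ * mapK (⇑α) η))⁻¹ * tpb 2 (ψ * mapK (⇑α) η) * tpb 0 (ψ * mapK (⇑α) η) =
      ((tpb 1 ψ)⁻¹ * tpb 2 ψ * tpb 0 ψ) * mapK (⇑α) (cob η) := by
  simp only [tpb_mul, tpb_mapK α hαΓ]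
  funext a z
  simp only [cob_one, mapK, Pi.mul_apply, Pi.inv_apply]
  generalize tpb 0 η a z = x₀
  generalize tpb 1 η a z = x₁
  generalize tpb 2 η a z = x₂
  generalize tpb 0 ψ a z = y₀
  generalize tpb 1 ψ a z = y₁
  generalize tpb 2 ψ a z = y₂
  calc (y₁ * α x₁)⁻¹ * (y₂ * α x₂) * (y₀ * α x₀)
      = α x₁⁻¹ * (y₁⁻¹ * y₂ * (α x₂ * y₀) * α x₀) := by
        simp only [mul_inv_rev, map_inv, mul_assoc]
    _ = y₁⁻¹ * y₂ * y₀ * (α x₂ * α x₀ * α x₁⁻¹) := by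
        rw [hcentral x₁⁻¹, hcentral x₂]
        simp only [mul_assoc]
    _ = y₁⁻¹ * y₂ * y₀ * α (x₀ * x₁⁻¹ * x₂) := by
        rw [← map_mul, ← map_mul, mul_comm x₂ x₀, mul_right_comm]

/-- a 1-cocycle `φ` with values in `C` lifts to a 1-cocycle
with values in `B` if and only if its semi-equivariant Dixmier–Douady
invariant `DD(φ) = [ν̄] ∈ H²` vanishes, i.e. `ν̄` is a coboundary. -/
theorem statement18 {Γ X ι A B C : Type*} [Group Γ] [MulAction Γ X]
    [CommGroup A] [Group B] [Group C] [MulDistribMulAction Γ A]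
    [MulDistribMulAction Γ B] [MulDistribMulAction Γ C]
    (U : ι → Set X) (α : A →* B) (β : B →* C)
    (hαΓ : ∀ (γ : Γ) (g : A), α (γ • g) = γ • α g)
    (hβΓ : ∀ (γ : Γ) (g : B), β (γ • g) = γ • β g)
    (hαinj : Function.Injective ⇑α)
    (hcentral : ∀ (x : A) (b : B), α x * b = b * α x)
    (hβsurj : Function.Surjective ⇑β)
    (hexact : ∀ b : B, β b = 1 ↔ b ∈ Set.range ⇑α)
    (φ : K Γ U C 1) (hφcoc : (tpb 1 φ)⁻¹ * tpb 2 φ * tpb 0 φ = 1)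
    (ψ : K Γ U B 1) (hψ : mapK (⇑β) ψ = φ)
    (ν : K Γ U A 2)
    (hν : mapK (⇑α) ν = (tpb 1 ψ)⁻¹ * tpb 2 ψ * tpb 0 ψ) :
    (∃ ψ' : K Γ U B 1, mapK (⇑β) ψ' = φ ∧
      (tpb 1 ψ')⁻¹ * tpb 2 ψ' * tpb 0 ψ' = 1) ↔
    (∃ η : K Γ U A 1, ν = cob η) := by
  constructor
  · rintro ⟨ψ', hψ', hcoc⟩
    have hdiff : ∀ a z, ∃ x : A, α x = (ψ' a z)⁻¹ * ψ a z := fun a z => by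
      refine (hexact _).1 ?_
      have h : β (ψ' a z) = β (ψ a z) := congrFun (congrFun (hψ'.trans hψ.symm) a) z
      simp [h]
    choose η hη using hdiff
    have hψη : ψ = ψ' * mapK (⇑α) η := by
      funext a z
      simp [mapK, hη]
    rw [hψη, cocycleDefect_mul_mapK α hαΓ hcentral, hcoc, one_mul] at hν
    exact ⟨η, funext fun a => funext fun z => hαinj (congrFun (congrFun hν a) z)⟩
  · rintro ⟨η, rfl⟩
    refine ⟨ψ * (mapK (⇑α) η)⁻¹, ?_, ?_⟩
    · rw [← hψ]
      funext a z
      have h : β (α (η a z)) = 1 := (hexact _).2 ⟨_, rfl⟩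
      simp [mapK, h]
    · have h := cocycleDefect_mul_mapK α hαΓ hcentral (ψ * (mapK (⇑α) η)⁻¹) η
      rw [inv_mul_cancel_right, ← hν] at h
      exact right_eq_mul.1 h

end SemiDD
end
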